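/- Let a group G act on a set X, let A ⊆ X, B ⊆ G, and let N ≥ 1 be a natural number. Let 𝒟′ be the collection of all nonempty finite intersections g₁B ∩ … ∩ gₘB of left translates of B (g₁, …, gₘ ∈ G). Assume: (a) 𝒟 is a G-lattice of subsets of X containing A and containing B′A := ⋃_{b ∈ B′} b•A for every B′ ∈ 𝒟′, and m is a mean on 𝒟 with m(A) > 0; (b) 𝒟″ is a G-lattice of subsets of G (for the left-multiplication action of G on itself) containing 𝒟′, and m′ is a mean on 𝒟″ with m′(B) > 0. Then there exist l ≥ 1 and B′ ∈ 𝒟′ with B′ ⊆ B and L_l(B′) (generic largeness for the left-multiplication action of G on itself) such that the set Y := {g ∈ G : L_{l−1}(gB′ ∩ B′)} is generic and symmetric (1 ∈ Y and Y⁻¹ = Y) and satisfies Yᴺ ⊆ St₁(B′A) ⊆ St₁(BA), where St₁(Z) := {g ∈ G : m(g•Z ∩ Z) > 0} and Yᴺ denotes the set of all products of N elements of Y. -/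

import Mathlib

open Pointwise

/-- A subset `D` of a group `G` is generic if finitely many left translates of `D` cover `G`. -/
def IsGeneric {G : Type*} [Group G] (D : Set G) : Prop :=
  ∃ F : Finset G, ∀ g : G, ∃ h ∈ F, h⁻¹ * g ∈ D

/-- A `G`-lattice of subsets of a `G`-set `X`. -/
def IsGLattice (G : Type*) {X : Type*} [Group G] [MulAction G X] (D : Set (Set X)) : Prop :=
  ∅ ∈ D ∧ Set.univ ∈ D ∧ (∀ (g : G), ∀ Y ∈ D, g • Y ∈ D) ∧
    (∀ Y ∈ D, ∀ Z ∈ D, Y ∩ Z ∈ D) ∧ (∀ Y ∈ D, ∀ Z ∈ D, Y ∪ Z ∈ D)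

/-- A mean on a `G`-lattice. -/
def IsMean (G : Type*) {X : Type*} [Group G] [MulAction G X] (D : Set (Set X))
    (m : Set X → ℝ) : Prop :=
  (∀ Y ∈ D, 0 ≤ m Y) ∧ (∀ Y ∈ D, ∀ Z ∈ D, Y ⊆ Z → m Y ≤ m Z) ∧
    (∀ (g : G), ∀ Y ∈ D, m (g • Y) = m Y) ∧ m ∅ = 0 ∧
    (∀ Y ∈ D, ∀ Z ∈ D, m (Y ∪ Z) = m Y + m Z - m (Y ∩ Z))

/-- The generic-largeness predicates `L_k`. -/
def LargeGen (G : Type*) {X : Type*} [Group G] [MulAction G X] : ℕ → Set X → Prop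
  | 0, Y => Y.Nonempty
  | k + 1, Y => IsGeneric {g : G | LargeGen G k (g • Y ∩ Y)}

/-- The family `𝒟′` of all nonempty finite intersections of left translates of `B`. -/
def FinIntTrans {G : Type*} [Group G] (B : Set G) (B' : Set G) : Prop :=
  ∃ k : ℕ, ∃ g : Fin (k + 1) → G, B' = ⋂ i, g i • B

namespace IsGeneric

variable {G : Type*} [Group G]

theorem mono {S T : Set G} (h : S ⊆ T) (hS : IsGeneric S) : IsGeneric T := by
  obtain ⟨F, hF⟩ := hS
  refine ⟨F, fun g => ?_⟩
  obtain ⟨k, hk, hg⟩ := hF g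
  exact ⟨k, hk, h hg⟩

theorem nonempty {S : Set G} (hS : IsGeneric S) : S.Nonempty := by
  obtain ⟨F, hF⟩ := hS
  obtain ⟨k, -, hk⟩ := hF 1
  exact ⟨_, hk⟩

theorem preimage_conj {S : Set G} (hS : IsGeneric S) (h : G) :
    IsGeneric {g : G | h⁻¹ * g * h ∈ S} := by
  classical
  obtain ⟨F, hF⟩ := hS
  refine ⟨F.image fun k => h * k * h⁻¹, fun g => ?_⟩
  obtain ⟨k, hk, hg⟩ := hF (h⁻¹ * g * h)
  refine ⟨h * k * h⁻¹, Finset.mem_image_of_mem _ hk, ?_⟩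
  simpa [mul_assoc] using hg

end IsGeneric

namespace LargeGen

variable {G X : Type*} [Group G] [MulAction G X]

theorem mono {k : ℕ} {Y Z : Set X} (h : Y ⊆ Z) (hY : LargeGen G k Y) : LargeGen G k Z := by
  induction k generalizing Y Z with
  | zero => exact Set.Nonempty.mono h hY
  | succ k ih =>
    exact IsGeneric.mono
      (fun g hg => ih (Set.inter_subset_inter (Set.smul_set_mono h) h) hg) hY

theorem of_succ {k : ℕ} {Y : Set X} (hY : LargeGen G (k + 1) Y) : LargeGen G k Y := by
  obtain ⟨g, hg⟩ := IsGeneric.nonempty hY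
  exact mono Set.inter_subset_right hg

theorem nonempty {k : ℕ} {Y : Set X} (hY : LargeGen G k Y) : Y.Nonempty := by
  induction k with
  | zero => exact hY
  | succ k ih => exact ih hY.of_succ

theorem smul {k : ℕ} {Y : Set X} (hY : LargeGen G k Y) (h : G) : LargeGen G k (h • Y) := by
  induction k generalizing Y with
  | zero => exact Set.Nonempty.smul_set hY
  | succ k ih =>
    refine IsGeneric.mono (fun g hg => ?_) (IsGeneric.preimage_conj hY h)
    have key := ih hg
    rwa [Set.smul_set_inter, smul_smul, mul_assoc, mul_inv_cancel_left, mul_smul] at key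

theorem inv_smul_inter {k : ℕ} {Y : Set X} {g : G} (h : LargeGen G k (g • Y ∩ Y)) :
    LargeGen G k (g⁻¹ • Y ∩ Y) := by
  have key := h.smul g⁻¹
  rwa [Set.smul_set_inter, inv_smul_smul, Set.inter_comm] at key

theorem inv_setOf_smul_inter (k : ℕ) (Y : Set X) :
    {g : G | LargeGen G k (g • Y ∩ Y)}⁻¹ = {g : G | LargeGen G k (g • Y ∩ Y)} := by
  ext g
  exact ⟨fun h => by simpa using inv_smul_inter (Set.mem_inv.mp h), fun h => inv_smul_inter h⟩

end LargeGen

theorem IsGLattice.biUnion_smul_mem {G X : Type*} [Group G] [MulAction G X]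
    {D : Set (Set X)} (hD : IsGLattice G D) {Y : Set X} (hY : Y ∈ D) (F : Finset G) :
    (⋃ h ∈ F, h • Y) ∈ D := by
  classical
  obtain ⟨hempty, -, hsmul, -, hunion⟩ := hD
  induction F using Finset.induction_on with
  | empty => simpa using hempty
  | insert g F _ ih =>
    rw [Finset.set_biUnion_insert]
    exact hunion _ (hsmul _ _ hY) _ ih

namespace IsMean

variable {G X : Type*} [Group G] [MulAction G X] {D : Set (Set X)} {m : Set X → ℝ}

theorem inter_biUnion_smul_eq_zero (hD : IsGLattice G D) (hm : IsMean G D m) {Y Z : Set X}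
    (hY : Y ∈ D) (hZ : Z ∈ D) (F : Finset G) (h : ∀ g ∈ F, m (Z ∩ g • Y) = 0) :
    m (Z ∩ ⋃ g ∈ F, g • Y) = 0 := by
  classical
  have hU := hD.biUnion_smul_mem hY
  obtain ⟨-, -, hsmul, hinter, -⟩ := hD
  obtain ⟨hnonneg, hmono, -, hzero, hmod⟩ := hm
  induction F using Finset.induction_on with
  | empty => simpa using hzero
  | insert g F _ ih =>
    have hgY := hinter _ hZ _ (hsmul g _ hY)
    have hFY := hinter _ hZ _ (hU F)
    have hF := ih fun k hk => h k (Finset.mem_insert_of_mem hk)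
    have hg := h g (Finset.mem_insert_self g F)
    rw [Finset.set_biUnion_insert, Set.inter_union_distrib_left, hmod _ hgY _ hFY, hg, hF]
    have h₁ := hnonneg _ (hinter _ hgY _ hFY)
    have h₂ := hmono _ (hinter _ hgY _ hFY) _ hgY Set.inter_subset_left
    linarith

/-- The return set of a set of positive mean is generic. -/
theorem isGeneric_setOf_pos (hD : IsGLattice G D) (hm : IsMean G D m) {Y : Set X}
    (hY : Y ∈ D) (hpos : 0 < m Y) : IsGeneric {g : G | 0 < m (g • Y ∩ Y)} := by
  classical
  by_contra hgen
  simp only [IsGeneric, Set.mem_ofPred_eq, not_exists, not_forall, not_and, not_lt] at hgen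
  have hnull {Z : Set X} := inter_biUnion_smul_eq_zero hD hm hY (Z := Z)
  have hU := hD.biUnion_smul_mem hY
  obtain ⟨-, huniv, hsmul, hinter, -⟩ := hD
  obtain ⟨hnonneg, hmono, hinv, -, hmod⟩ := hm
  have large (n : ℕ) : ∃ F : Finset G, n * m Y ≤ m (⋃ h ∈ F, h • Y) := by
    induction n with
    | zero => exact ⟨∅, by simpa using hnonneg _ (hU ∅)⟩
    | succ n ih =>
      obtain ⟨F, hF⟩ := ih
      obtain ⟨g, hg⟩ := hgen F
      refine ⟨insert g F, ?_⟩
      have hdisj : m (g • Y ∩ ⋃ h ∈ F, h • Y) = 0 := by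
        refine hnull (hsmul g _ hY) F fun k hk => ?_
        have hD₁ := hinter _ (hsmul (k⁻¹ * g) _ hY) _ hY
        have hk₀ := le_antisymm (hg k hk) (hnonneg _ hD₁)
        rw [← hinv k _ hD₁] at hk₀
        rwa [Set.smul_set_inter, smul_smul, mul_inv_cancel_left] at hk₀
      rw [Finset.set_biUnion_insert, hmod _ (hsmul g _ hY) _ (hU F), hinv g _ hY, hdisj]
      push_cast
      linarith
  obtain ⟨n, hn⟩ := exists_nat_gt (m Set.univ / m Y)
  obtain ⟨F, hF⟩ := large n
  have hle := hmono _ (hU F) _ huniv (Set.subset_univ _)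
  rw [div_lt_iff₀ hpos] at hn
  linarith

/-- A set of positive mean is large at every level. -/
theorem largeGen_of_pos (hD : IsGLattice G D) (hm : IsMean G D m) (k : ℕ) {Y : Set X}
    (hY : Y ∈ D) (hpos : 0 < m Y) : LargeGen G k Y := by
  induction k generalizing Y with
  | zero =>
    rw [LargeGen, Set.nonempty_iff_ne_empty]
    rintro rfl
    exact hpos.ne' hm.2.2.2.1
  | succ k ih =>
    exact IsGeneric.mono (fun g hg => ih (hD.2.2.2.1 _ (hD.2.2.1 g _ hY) _ hY) hg)
      (isGeneric_setOf_pos hD hm hY hpos)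

/-- Almost-stabilizing a set is subadditive under products. -/
theorem sub_le_smul_mul_inter (hD : IsGLattice G D) (hm : IsMean G D m) {Z : Set X} (hZ : Z ∈ D)
    {g h : G} {a b : ℝ} (hg : m Z - a ≤ m (g • Z ∩ Z)) (hh : m Z - b ≤ m (h • Z ∩ Z)) :
    m Z - (a + b) ≤ m ((g * h) • Z ∩ Z) := by
  obtain ⟨-, -, hsmul, hinter, hunion⟩ := hD
  obtain ⟨-, hmono, hinv, -, hmod⟩ := hm
  have hD₁ := hinter _ (hsmul g _ hZ) _ hZ
  have hD₂ := hinter _ (hsmul h _ hZ) _ hZ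
  have hD₃ := hsmul g _ hD₂
  have hmodular := hmod _ hD₁ _ hD₃
  have hle_union : m (g • Z ∩ Z ∪ g • (h • Z ∩ Z)) ≤ m (g • Z) :=
    hmono _ (hunion _ hD₁ _ hD₃) _ (hsmul g _ hZ)
      (Set.union_subset Set.inter_subset_left (Set.smul_set_mono Set.inter_subset_right))
  have hle_inter : m (g • Z ∩ Z ∩ g • (h • Z ∩ Z)) ≤ m ((g * h) • Z ∩ Z) := by
    refine hmono _ (hinter _ hD₁ _ hD₃) _ (hinter _ (hsmul _ _ hZ) _ hZ) ?_
    rintro x ⟨hx, hx'⟩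
    rw [Set.smul_set_inter, smul_smul] at hx'
    exact ⟨hx'.1, hx.2⟩
  rw [hinv g _ hD₂] at hmodular
  rw [hinv g _ hZ] at hle_union
  linarith

theorem sub_le_smul_inter_of_mem_pow (hD : IsGLattice G D) (hm : IsMean G D m) {Z : Set X}
    (hZ : Z ∈ D) {Y : Set G} {a : ℝ} (hY : ∀ g ∈ Y, m Z - a ≤ m (g • Z ∩ Z)) (n : ℕ) {g : G}
    (hg : g ∈ Y ^ n) : m Z - n * a ≤ m (g • Z ∩ Z) := by
  induction n generalizing g with
  | zero =>
    obtain rfl : g = 1 := by simpa using hg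
    simp
  | succ n ih =>
    rw [pow_succ] at hg
    obtain ⟨x, hx, y, hy, rfl⟩ := hg
    have key := sub_le_smul_mul_inter hD hm hZ (ih hx) (hY y hy)
    push_cast
    linarith

end IsMean

namespace FinIntTrans

variable {G : Type*} [Group G] {B : Set G}

theorem of_iInter {ι : Type*} [Finite ι] [Nonempty ι] (g : ι → G) :
    FinIntTrans B (⋂ i, g i • B) := by
  obtain ⟨n, ⟨e⟩⟩ := Finite.exists_equiv_fin ι
  cases n with
  | zero => exact (e (Classical.arbitrary ι)).elim0
  | succ k => exact ⟨k, g ∘ e.symm, (e.symm.surjective.iInter_comp fun i => g i • B).symm⟩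

theorem self : FinIntTrans B B := by
  simpa [Set.iInter_const] using of_iInter (B := B) fun _ : Unit => (1 : G)

theorem smul {C : Set G} (hC : FinIntTrans B C) (h : G) : FinIntTrans B (h • C) := by
  obtain ⟨k, g, rfl⟩ := hC
  exact ⟨k, fun i => h * g i, by simp only [Set.smul_set_iInter, mul_smul]⟩

theorem inter {C C' : Set G} (hC : FinIntTrans B C) (hC' : FinIntTrans B C') :
    FinIntTrans B (C ∩ C') := by
  obtain ⟨k, g, rfl⟩ := hC
  obtain ⟨k', g', rfl⟩ := hC'
  simpa [Set.iInter_sum] using of_iInter (B := B) (Sum.elim g g')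

end FinIntTrans

/-- For sets of reals `S l` with a common lower bound and a common element `b`, some `S (l + 1)`
has an element exceeding no element of `S l` by more than `ε`. -/
theorem exists_mem_succ_forall_sub_le (S : ℕ → Set ℝ) {a b ε : ℝ}
    (ha : ∀ l, ∀ x ∈ S l, a ≤ x) (hb : ∀ l, b ∈ S l) (hε : 0 < ε) :
    ∃ l, ∃ x ∈ S (l + 1), ∀ y ∈ S l, x - ε ≤ y := by
  have hbelow (l : ℕ) : BddBelow (S l) := ⟨a, ha l⟩
  have habove : BddAbove (Set.range fun l => sInf (S l)) := by
    refine ⟨b, ?_⟩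
    rintro _ ⟨l, rfl⟩
    exact csInf_le (hbelow l) (hb l)
  obtain ⟨l, hl⟩ := exists_lt_of_lt_ciSup
    (show (⨆ l, sInf (S l)) - ε / 2 < ⨆ l, sInf (S l) by linarith)
  obtain ⟨x, hx, hxlt⟩ := exists_lt_of_csInf_lt ⟨b, hb (l + 1)⟩
    (show sInf (S (l + 1)) < sInf (S (l + 1)) + ε / 2 by linarith)
  refine ⟨l, x, hx, fun y hy => ?_⟩
  have h₁ := le_ciSup habove (l + 1)
  have h₂ := csInf_le (hbelow l) hy
  linarith

/-- Proposition 2.10 (semantic form of the strengthened Massicot–Wagner stabilizer theorem):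
under the amenability hypotheses, there are `l ≥ 1` and `B' ∈ 𝒟′` contained in `B` with
`L_l(B')` such that `Y := {g : L_{l-1}(gB' ∩ B')}` is generic, symmetric, and
`Yᴺ ⊆ St₁(B'A) ⊆ St₁(BA)`. -/
theorem massicot_wagner_variant {G X : Type*} [Group G] [MulAction G X]
    (A : Set X) (B : Set G) (N : ℕ) (hN : 1 ≤ N)
    (D : Set (Set X)) (m : Set X → ℝ)
    (hD : IsGLattice G D) (hm : IsMean G D m)
    (hA : A ∈ D)
    (hB'A : ∀ B' : Set G, FinIntTrans B B' → B' • A ∈ D)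
    (hApos : 0 < m A)
    (D'' : Set (Set G)) (m' : Set G → ℝ)
    (hD'' : IsGLattice G D'') (hm' : IsMean G D'' m')
    (hD'sub : ∀ B' : Set G, FinIntTrans B B' → B' ∈ D'')
    (hBpos : 0 < m' B) :
    ∃ l : ℕ, 1 ≤ l ∧ ∃ B' : Set G, FinIntTrans B B' ∧ B' ⊆ B ∧ LargeGen G l B' ∧
      ∃ Y : Set G, Y = {g : G | LargeGen G (l - 1) (g • B' ∩ B')} ∧
        IsGeneric Y ∧ (1 : G) ∈ Y ∧ Y⁻¹ = Y ∧
        Y ^ N ⊆ {g : G | 0 < m (g • (B' • A) ∩ (B' • A))} ∧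
        {g : G | 0 < m (g • (B' • A) ∩ (B' • A))} ⊆
          {g : G | 0 < m (g • (B • A) ∩ (B • A))} := by
  have hle {C : Set G} {x : G} (hC : FinIntTrans B C) (hx : x ∈ C) : m A ≤ m (C • A) := by
    rw [← hm.2.2.1 x _ hA]
    exact hm.2.1 _ (hD.2.2.1 x _ hA) _ (hB'A C hC) (Set.smul_set_subset_smul hx)
  have hNpos : (0 : ℝ) < N := by exact_mod_cast hN
  obtain ⟨l, _, ⟨B', ⟨hB', hB'B, hlarge⟩, rfl⟩, hmin⟩ := exists_mem_succ_forall_sub_le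
    (fun l => (fun C => m (C • A)) '' {C : Set G | FinIntTrans B C ∧ C ⊆ B ∧ LargeGen G l C})
    (a := m A) (b := m (B • A)) (ε := m A / (2 * N))
    (by
      rintro l _ ⟨C, ⟨hC, -, hl⟩, rfl⟩
      obtain ⟨x, hx⟩ := hl.nonempty
      exact hle hC hx)
    (fun l => ⟨B, ⟨.self, subset_rfl,
      hm'.largeGen_of_pos hD'' l (hD'sub B .self) hBpos⟩, rfl⟩)
    (by positivity)
  have hZ := hB'A B' hB'
  have hW := hB'A B .self
  have hinter (g : G) {Z : Set X} (h : Z ∈ D) : g • Z ∩ Z ∈ D := hD.2.2.2.1 _ (hD.2.2.1 g _ h) _ h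
  refine ⟨l + 1, by omega, B', hB', hB'B, hlarge, _, rfl, hlarge, ?_,
    LargeGen.inv_setOf_smul_inter _ _, fun g hg => ?_, fun g hg => ?_⟩
  · simpa using hlarge.of_succ
  · have hY : ∀ g ∈ {g : G | LargeGen G l (g • B' ∩ B')},
        m (B' • A) - m A / (2 * N) ≤ m (g • (B' • A) ∩ (B' • A)) := by
      intro g hg
      have hC := (hB'.smul g).inter hB'
      refine (hmin _ ⟨_, ⟨hC, Set.inter_subset_right.trans hB'B, hg⟩, rfl⟩).trans
        (hm.2.1 _ (hB'A _ hC) _ (hinter g hZ) (Set.subset_inter ?_ ?_))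
      · rw [← smul_assoc]
        exact Set.smul_subset_smul_right Set.inter_subset_left
      · exact Set.smul_subset_smul_right Set.inter_subset_right
    have key := hm.sub_le_smul_inter_of_mem_pow hD hZ hY N hg
    obtain ⟨x, hx⟩ := hlarge.nonempty
    have hAZ := hle hB' hx
    have hmul : (N : ℝ) * (m A / (2 * N)) = m A / 2 := by field_simp
    rw [hmul] at key
    rw [Set.mem_ofPred_eq]
    linarith
  · have hsub : B' • A ⊆ B • A := Set.smul_subset_smul_right hB'B
    exact lt_of_lt_of_le hg (hm.2.1 _ (hinter g hZ) _ (hinter g hW)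
      (Set.inter_subset_inter (Set.smul_set_mono hsub) hsub))
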